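/- arXiv:2507.09855 — 4 statements merged into one kernel-verified Lean document; each statement's English description precedes it below -/
import Mathlib

section
/- Dirac's theorem: Let G be a simple graph on n vertices with n ≥ 3 such that every vertex of G has degree at least n/2. Then G contains a Hamiltonian cycle, i.e., a cycle that visits every vertex of G exactly once. -/
namespace SimpleGraph

variable {V : Type*} {G : SimpleGraph V} {u v : V}

/-- Two crossing chords at the ends of a path close it up to a cycle on the same vertices. -/
theorem Walk.IsPath.exists_isCycle_of_crossing_chords {p : G.Walk u v} (hp : p.IsPath)
    (hlen : 2 ≤ p.length) {i : ℕ} (hi : i < p.length) (hu : G.Adj u (p.getVert (i + 1)))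
    (hv : G.Adj v (p.getVert i)) :
    ∃ (w : V) (c : G.Walk w w), c.IsCycle ∧ c.length = p.length + 1 := by
  have hmin : min (i + 1) p.length = i + 1 := by lia
  let q : G.Walk u (p.getVert (i + 1)) :=
    (p.take i).append (.cons hv.symm (p.drop (i + 1)).reverse)
  have hqlen : q.length = p.length := by
    simp only [q, length_append, length_cons, length_reverse, take_length, drop_length]
    lia
  have hq : q.IsPath := by
    refine .mk' ?_
    have hperm : q.support.Perm p.support := by
      simp only [q, support_append, support_cons, support_reverse, List.tail_cons, support_take,
        drop_support_eq_support_drop_min, hmin]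
      exact ((List.reverse_perm _).append_left _).trans (.of_eq (List.take_append_drop _ _))
    exact hperm.nodup_iff.mpr hp.support_nodup
  refine ⟨_, .cons hu.symm q, ?_, by simp [hqlen]⟩
  rw [isCycle_iff_isPath_tail_and_le_length]
  exact ⟨by simpa using hq, by simp only [length_cons]; lia⟩

/-- A vertex off a cycle but adjacent to it extends the cycle, cut open, to a path. -/
theorem Walk.IsCycle.exists_isPath_of_adj {w x y : V} {c : G.Walk w w} (hc : c.IsCycle)
    (hx : x ∉ c.support) (hy : y ∈ c.support) (h : G.Adj x y) :
    ∃ (z : V) (p : G.Walk x z), p.IsPath ∧ p.length = c.length := by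
  classical
  have hr : (c.rotate y hy).IsCycle := hc.rotate hy
  have hlen := hc.three_le_length
  refine ⟨_, .cons h (c.rotate y hy).dropLast, ?_, ?_⟩
  · rw [cons_isPath_iff]
    refine ⟨hr.isPath_dropLast, fun hmem => hx ?_⟩
    rw [support_dropLast hr.not_nil] at hmem
    exact (mem_support_rotate_iff c y hy).mp (List.mem_of_mem_dropLast hmem)
  · simp only [length_cons, length_dropLast, length_rotate]
    lia

/-- If all neighbors of `u` lie on a walk from `u`, then at least `G.degree u` edges of the walk
end in a neighbor of `u`. -/
theorem Walk.degree_le_card_filter_adj_succ [Fintype V] [DecidableRel G.Adj] (p : G.Walk u v)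
    (h : ∀ x, G.Adj u x → x ∈ p.support) :
    G.degree u ≤ ((Finset.range p.length).filter fun i => G.Adj u (p.getVert (i + 1))).card := by
  classical
  rw [← card_neighborFinset_eq_degree]
  refine le_trans (Finset.card_le_card ?_) (Finset.card_image_le (f := fun i => p.getVert (i + 1)))
  intro x hx
  rw [mem_neighborFinset] at hx
  obtain ⟨j, rfl, hj⟩ := mem_support_iff_exists_getVert.mp (h x hx)
  obtain _ | j := j
  · simp at hx
  · exact Finset.mem_image.mpr ⟨j, by simpa using ⟨by lia, hx⟩, rfl⟩

/-- If all neighbors of `v` lie on a walk to `v`, then at least `G.degree v` edges of the walk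
start in a neighbor of `v`. -/
theorem Walk.degree_le_card_filter_adj [Fintype V] [DecidableRel G.Adj] (p : G.Walk u v)
    (h : ∀ x, G.Adj v x → x ∈ p.support) :
    G.degree v ≤ ((Finset.range p.length).filter fun i => G.Adj v (p.getVert i)).card := by
  classical
  rw [← card_neighborFinset_eq_degree]
  refine le_trans (Finset.card_le_card ?_) (Finset.card_image_le (f := p.getVert))
  intro x hx
  rw [mem_neighborFinset] at hx
  obtain ⟨j, rfl, hj⟩ := mem_support_iff_exists_getVert.mp (h x hx)
  have hne : j ≠ p.length := by
    rintro rfl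
    simp at hx
  exact Finset.mem_image.mpr ⟨j, by simpa using ⟨by lia, hx⟩, rfl⟩

end SimpleGraph

open SimpleGraph Walk in
/-- **Dirac's theorem.** If `G` is a simple graph on `n ≥ 3` vertices in which every
vertex has degree at least `n / 2` (i.e. `n ≤ 2 * deg v`), then `G` contains a
Hamiltonian cycle. -/
theorem dirac_theorem {V : Type*} [Fintype V] [DecidableEq V]
    (G : SimpleGraph V) [DecidableRel G.Adj]
    (hn : 3 ≤ Fintype.card V)
    (hdeg : ∀ v : V, Fintype.card V ≤ 2 * G.degree v) :
    ∃ (v : V) (w : G.Walk v v), w.IsHamiltonianCycle := by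
  have : Nonempty V := Fintype.card_pos_iff.mp (by lia)
  obtain ⟨u, v, p, hp, hmax⟩ := exists_isPath_forall_isPath_length_le_length G
  have hu : ∀ x, G.Adj u x → x ∈ p.support := fun x hx => by
    by_contra hmem
    have := hmax _ _ _ ((cons_isPath_iff hx.symm p).mpr ⟨hp, hmem⟩)
    simp at this
  have hv : ∀ x, G.Adj v x → x ∈ p.support := fun x hx => by
    by_contra hmem
    have := hmax _ _ _ (hp.concat hmem hx)
    simp at this
  have hA := p.degree_le_card_filter_adj_succ hu
  have hB := p.degree_le_card_filter_adj hv
  have hlt := hp.length_lt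
  have hdu := hdeg u
  have hdv := hdeg v
  have hulen : G.degree u ≤ p.length :=
    hA.trans ((Finset.card_filter_le _ _).trans (Finset.card_range _).le)
  obtain ⟨i, hi⟩ := Finset.inter_nonempty_of_card_lt_card_add_card
    (Finset.filter_subset _ _) (Finset.filter_subset _ _)
    (show (Finset.range p.length).card < _ from
      (Finset.card_range _).trans_lt ((by lia : p.length < G.degree u + G.degree v).trans_le
        (add_le_add hA hB)))
  simp only [Finset.mem_inter, Finset.mem_filter, Finset.mem_range] at hi
  obtain ⟨w, c, hc, hclen⟩ :=
    hp.exists_isCycle_of_crossing_chords (by lia) hi.1.1 hi.1.2 hi.2.2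
  refine ⟨w, c, isHamiltonianCycle_isCycle_and_isHamiltonian_tail.mpr
    ⟨hc, hc.isPath_tail.isHamiltonian_of_mem fun x => ?_⟩⟩
  by_contra hx
  rw [support_tail_of_not_nil c hc.not_nil] at hx
  have hx' : x ∉ c.support := by
    rwa [mem_support_iff, not_or, and_iff_right_of_imp]
    rintro hx' rfl
    exact hx' (end_mem_tail_support hc.not_nil)
  have hcard : c.support.tail.toFinset.card = p.length + 1 := by
    rw [List.toFinset_card_of_nodup hc.support_nodup, List.length_tail, length_support, hclen]
    rfl
  have hdisj : ¬ Disjoint (G.neighborFinset x) c.support.tail.toFinset := fun hd => by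
    have hle := Finset.card_le_univ (insert x (G.neighborFinset x ∪ c.support.tail.toFinset))
    rw [Finset.card_insert_of_notMem (by simpa using hx), Finset.card_union_of_disjoint hd,
      card_neighborFinset_eq_degree, hcard] at hle
    have := hdeg x
    lia
  obtain ⟨y, hxy, hy⟩ := Finset.not_disjoint_iff.mp hdisj
  obtain ⟨z, r, hr, hrlen⟩ := hc.exists_isPath_of_adj hx'
    (List.mem_of_mem_tail (List.mem_toFinset.mp hy)) ((mem_neighborFinset _ _ _).mp hxy)
  have := hmax _ _ _ hr
  lia
end

section
/- Edge-connectivity under the Dirac condition: Let G be a simple graph on n vertices with n ≥ 2 in which every vertex has degree at least n/2. Then for every set F of edges of G with |F| < ⌈n/2⌉, the graph obtained from G by deleting the edges in F is connected; that is, the edge-connectivity of G is at least ⌈n/2⌉. -/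
/-- If every vertex of a nonempty finite set `S` has degree at least `k ≥ #S`, then any set of
edges containing all edges that leave `S` has at least `k` elements. -/
theorem SimpleGraph.le_card_of_forall_boundary_mem {V : Type*} [Fintype V] [DecidableEq V]
    (G : SimpleGraph V) [DecidableRel G.Adj] {k : ℕ} {S : Finset V} (hS : S.Nonempty)
    (hSk : S.card ≤ k) (hdeg : ∀ v ∈ S, k ≤ G.degree v) (F : Finset (Sym2 V))
    (hF : ∀ v ∈ S, ∀ w ∉ S, G.Adj v w → s(v, w) ∈ F) : k ≤ F.card := by
  have hout : ∀ v ∈ S, k - S.card + 1 ≤ (G.neighborFinset v \ S).card := by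
    intro v hv
    have hsub : G.neighborFinset v ⊆ (G.neighborFinset v \ S) ∪ S.erase v := by
      intro w hw
      have hne : w ≠ v := (G.ne_of_adj ((G.mem_neighborFinset v w).1 hw)).symm
      by_cases hwS : w ∈ S <;> simp_all
    have hcard := (Finset.card_le_card hsub).trans (Finset.card_union_le _ _)
    rw [G.card_neighborFinset_eq_degree, Finset.card_erase_of_mem hv] at hcard
    have hk := hdeg v hv
    have hpos := hS.card_pos
    omega
  have hinj : (S.sigma fun v => G.neighborFinset v \ S).card ≤ F.card := by
    refine Finset.card_le_card_of_injOn (fun p => s(p.1, p.2)) ?_ ?_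
    · rintro ⟨v, w⟩ hp
      simp only [Finset.mem_coe, Finset.mem_sigma, Finset.mem_sdiff, G.mem_neighborFinset] at hp
      exact hF v hp.1 w hp.2.2 hp.2.1
    · rintro ⟨v, w⟩ hp ⟨v', w'⟩ hq h
      simp only [Finset.mem_coe, Finset.mem_sigma, Finset.mem_sdiff] at hp hq
      rcases Sym2.eq_iff.1 h with ⟨rfl, rfl⟩ | ⟨rfl, rfl⟩
      · rfl
      · exact absurd hp.1 hq.2.2
  rw [Finset.card_sigma] at hinj
  have hsum := Finset.card_nsmul_le_sum S _ _ hout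
  rw [smul_eq_mul] at hsum
  obtain ⟨d, rfl⟩ := Nat.exists_eq_add_of_le hSk
  have hpos := hS.card_pos
  rw [Nat.add_sub_cancel_left] at hsum
  nlinarith [Nat.mul_le_mul_right d hpos]


/-- **Edge-connectivity under the Dirac condition.** If `G` is a simple graph on
`n ≥ 2` vertices in which every vertex has degree at least `n / 2`, then deleting any
set `F` of fewer than `⌈n / 2⌉ = (n + 1) / 2` edges of `G` leaves a connected graph;
that is, the edge-connectivity of `G` is at least `⌈n / 2⌉`. -/
theorem dirac_edge_connectivity
    {V : Type*} [Fintype V] [DecidableEq V] (G : SimpleGraph V) [DecidableRel G.Adj]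
    (hn : 2 ≤ Fintype.card V)
    (hdeg : ∀ v : V, Fintype.card V ≤ 2 * G.degree v) :
    ∀ F : Finset (Sym2 V), ↑F ⊆ G.edgeSet → F.card < (Fintype.card V + 1) / 2 →
      (G.deleteEdges ↑F).Connected := by
  classical
  intro F _ hlt
  have hcut : ∀ S : Finset V, S.Nonempty → 2 * S.card ≤ Fintype.card V →
      ¬ ∀ v ∈ S, ∀ w ∉ S, G.Adj v w → s(v, w) ∈ F := fun S hS hcard hF =>
    hlt.not_ge <| G.le_card_of_forall_boundary_mem hS (by omega)
      (fun v _ => by have := hdeg v; omega) F hF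
  have : Nonempty V := Fintype.card_pos_iff.1 (by omega)
  refine ⟨fun u v => ?_⟩
  by_contra huv
  set S : Finset V := {w | (G.deleteEdges ↑F).Reachable u w} with hS
  have hboundary : ∀ x ∈ S, ∀ y ∉ S, G.Adj x y → s(x, y) ∈ F := by
    intro x hx y hy hxy
    by_contra hnot
    simp only [hS, Finset.mem_filter_univ] at hx hy
    exact hy (hx.trans (SimpleGraph.Adj.reachable
      (SimpleGraph.deleteEdges_adj.2 ⟨hxy, by simpa using hnot⟩)))
  have hcompl := S.card_add_card_compl
  by_cases hhalf : 2 * S.card ≤ Fintype.card V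
  · exact hcut S ⟨u, by simp [hS]⟩ hhalf hboundary
  · refine hcut Sᶜ ⟨v, by simpa [hS] using huv⟩ (by omega) fun x hx y hy hxy => ?_
    rw [Sym2.eq_swap]
    exact hboundary y (by simpa using hy) x (by simpa using hx) hxy.symm
end

section
/- The gap-counter constraints determine the coverage-gap length uniquely: Let T ≥ 1 be an integer, let y : {1,…,T} → {0,1}, and let ω : {1,…,T} → ℝ satisfy ω_t ≥ 0 for all t, ω_1 = 1 − y_1, ω_t ≤ T(1 − y_t) for all t, and, for all t ≥ 2, ω_t − ω_{t−1} ≤ 1 and ω_t − ω_{t−1} ≥ 1 − T·y_t. Then for every t ∈ {1,…,T}, ω_t equals the length of the maximal run of zeros of y ending at t, i.e., ω_t = max{k ≥ 0 : y_s = 0 for all s with t − k + 1 ≤ s ≤ t}. -/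
/-- The length of the maximal run of zeros of the timeline `y` ending at time step `t`:
the largest `k ≥ 0` (necessarily `k ≤ t`) such that `y s = 0` for all `s` with
`t - k + 1 ≤ s ≤ t`. -/
noncomputable def zeroRunEndingAt (y : ℕ → ℝ) (t : ℕ) : ℕ :=
  sSup {k : ℕ | k ≤ t ∧ ∀ s : ℕ, t - k < s → s ≤ t → y s = 0}

theorem isGreatest_zeroRunEndingAt (y : ℕ → ℝ) (t : ℕ) :
    IsGreatest {k : ℕ | k ≤ t ∧ ∀ s : ℕ, t - k < s → s ≤ t → y s = 0}
      (zeroRunEndingAt y t) := by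
  have hbdd : BddAbove {k : ℕ | k ≤ t ∧ ∀ s : ℕ, t - k < s → s ≤ t → y s = 0} :=
    ⟨t, fun _ hk => hk.1⟩
  exact ⟨Nat.sSup_mem ⟨0, Nat.zero_le t, fun s h₁ h₂ => by omega⟩ hbdd,
    fun _ hk => le_csSup hbdd hk⟩

theorem zeroRunEndingAt_zero (y : ℕ → ℝ) : zeroRunEndingAt y 0 = 0 :=
  Nat.le_zero.mp (isGreatest_zeroRunEndingAt y 0).1.1

theorem zeroRunEndingAt_of_ne_zero {y : ℕ → ℝ} {t : ℕ} (h : y t ≠ 0) :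
    zeroRunEndingAt y t = 0 := by
  obtain ⟨hle, hzero⟩ := (isGreatest_zeroRunEndingAt y t).1
  by_contra hne
  exact h (hzero t (by omega) le_rfl)

theorem zeroRunEndingAt_succ_of_eq_zero {y : ℕ → ℝ} {t : ℕ} (h : y (t + 1) = 0) :
    zeroRunEndingAt y (t + 1) = zeroRunEndingAt y t + 1 := by
  obtain ⟨⟨hle, hzero⟩, hmax⟩ := isGreatest_zeroRunEndingAt y t
  obtain ⟨⟨hle', hzero'⟩, hmax'⟩ := isGreatest_zeroRunEndingAt y (t + 1)
  apply le_antisymm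
  · have := hmax (a := zeroRunEndingAt y (t + 1) - 1)
      ⟨by omega, fun s h₁ h₂ => hzero' s (by omega) (by omega)⟩
    omega
  · refine hmax' ⟨by omega, fun s h₁ h₂ => ?_⟩
    rcases Nat.le_succ_iff.mp h₂ with hs | rfl
    · exact hzero s (by omega) hs
    · exact h

/-- **The gap-counter constraints determine the coverage-gap length uniquely.**
If `y : {1,…,T} → {0,1}` and `ω` satisfies `ω t ≥ 0`, `ω 1 = 1 - y 1`,
`ω t ≤ T(1 - y t)`, and for `t ≥ 2` both `ω t - ω (t-1) ≤ 1` and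
`ω t - ω (t-1) ≥ 1 - T · y t`, then for every `t ∈ {1,…,T}`, `ω t` equals the length
of the maximal run of zeros of `y` ending at `t`. -/
theorem gap_counter_constraints_unique
    (T : ℕ) (hT : 1 ≤ T) (y ω : ℕ → ℝ)
    (hy : ∀ t ∈ Finset.Icc 1 T, y t = 0 ∨ y t = 1)
    (hω_nonneg : ∀ t ∈ Finset.Icc 1 T, 0 ≤ ω t)
    (hω_init : ω 1 = 1 - y 1)
    (hω_ub : ∀ t ∈ Finset.Icc 1 T, ω t ≤ (T : ℝ) * (1 - y t))
    (hω_inc : ∀ t ∈ Finset.Icc 2 T, ω t - ω (t - 1) ≤ 1)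
    (hω_lb : ∀ t ∈ Finset.Icc 2 T, ω t - ω (t - 1) ≥ 1 - (T : ℝ) * y t) :
    ∀ t ∈ Finset.Icc 1 T, ω t = (zeroRunEndingAt y t : ℝ) := by
  intro t ht
  obtain ⟨h1, hle⟩ := Finset.mem_Icc.mp ht
  clear ht
  induction t, h1 using Nat.le_induction with
  | base =>
    rw [hω_init]
    rcases hy 1 (Finset.mem_Icc.mpr ⟨le_rfl, hT⟩) with h | h
    · rw [zeroRunEndingAt_succ_of_eq_zero (t := 0) h, zeroRunEndingAt_zero, h]
      norm_num
    · rw [zeroRunEndingAt_of_ne_zero (by simp [h]), h]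
      norm_num
  | succ t h1 ih =>
    have hmem : t + 1 ∈ Finset.Icc 1 T := Finset.mem_Icc.mpr ⟨by omega, hle⟩
    have hmem' : t + 1 ∈ Finset.Icc 2 T := Finset.mem_Icc.mpr ⟨by omega, hle⟩
    rcases hy (t + 1) hmem with h | h
    · have hinc := hω_inc (t + 1) hmem'
      have hlb := hω_lb (t + 1) hmem'
      rw [Nat.add_sub_cancel] at hinc hlb
      rw [h] at hlb
      rw [zeroRunEndingAt_succ_of_eq_zero h, Nat.cast_add_one, ← ih (by omega)]
      linarith
    · have hnonneg := hω_nonneg (t + 1) hmem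
      have hub := hω_ub (t + 1) hmem
      rw [h] at hub
      rw [zeroRunEndingAt_of_ne_zero (by simp [h]), Nat.cast_zero]
      linarith
end

section
/- Correctness of the max-ISL constraints: Let 𝒥 be a finite set, let W : 𝒥 × 𝒥 → {0,1} be symmetric with W_{jj} = 0 for all j, and let x : 𝒥 → {0,1} satisfy Σ_{j∈𝒥} x_j ≥ 3 and, for every k ∈ 𝒥, Σ_{j∈𝒥, j≠k} W_{jk} x_j ≥ (1/2) Σ_{j∈𝒥} x_j. Then the simple graph whose vertex set is S = {j ∈ 𝒥 : x_j = 1} and in which distinct j, k ∈ S are adjacent exactly when W_{jk} = 1 contains a Hamiltonian cycle. -/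
namespace SimpleGraph

variable {V : Type*} {G : SimpleGraph V} {u v : V}

namespace Walk

/-- If `p` is longest among all paths, then every neighbor of its last vertex lies on `p`. -/
lemma IsPath.mem_support_of_adj_of_length_maximal {p : G.Walk u v} (hp : p.IsPath)
    (hmax : ∀ (a b : V) (q : G.Walk a b), q.IsPath → q.length ≤ p.length)
    {w : V} (hw : G.Adj v w) : w ∈ p.support := by
  by_contra hmem
  have := hmax _ _ _ (hp.concat hmem hw)
  simp at this

/-- Crossing chords at the two ends of a path `p` let its vertices be rearranged into a path
whose endpoints are adjacent. -/
lemma IsPath.exists_isPath_adj_of_crossing {p : G.Walk u v} (hp : p.IsPath) {i : ℕ}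
    (hi : i < p.length) (hu : G.Adj u (p.getVert (i + 1))) (hv : G.Adj v (p.getVert i)) :
    ∃ (a b : V) (q : G.Walk a b), q.IsPath ∧ G.Adj b a ∧ q.support.Perm p.support := by
  let q := (p.drop (i + 1)).append (cons hv (p.take i).reverse)
  have hq : q.support.Perm p.support := by
    have hmin : min (i + 1) p.length = i + 1 := by omega
    simp only [q, support_append, support_cons, List.tail_cons, support_reverse, support_take,
      drop_support_eq_support_drop_min, hmin]
    refine ((List.reverse_perm _).append_left _).trans (List.perm_append_comm.trans ?_)
    rw [List.take_append_drop]
  exact ⟨_, _, q, (isPath_def q).2 (hq.nodup_iff.2 hp.support_nodup), hu, hq⟩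

/-- A path of length at least two with adjacent endpoints closes up to a cycle. -/
lemma IsPath.isCycle_cons {p : G.Walk u v} (hp : p.IsPath) (hlen : 2 ≤ p.length)
    (h : G.Adj v u) : (cons h p).IsCycle := by
  refine (cons_isCycle_iff p h).2 ⟨hp, fun hmem => ?_⟩
  have := hp.length_eq_one_of_mem_edges (Sym2.eq_swap ▸ hmem)
  omega

/-- A vertex off a cycle but adjacent to it yields a path as long as the cycle. -/
lemma IsCycle.exists_isPath_length_eq {c : G.Walk u u} (hc : c.IsCycle) {x y : V}
    (hx : x ∈ c.support) (hy : y ∉ c.support) (hxy : G.Adj x y) :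
    ∃ (a : V) (q : G.Walk a y), q.IsPath ∧ q.length = c.length := by
  classical
  have hr := hc.rotate hx
  refine ⟨_, (c.rotate x hx).tail.concat hxy, hr.isPath_tail.concat ?_ hxy, ?_⟩
  · rw [support_tail_of_not_nil _ hr.not_nil]
    exact fun h => hy ((mem_support_rotate_iff c x hx).1 (List.mem_of_mem_tail h))
  · rw [length_concat, length_tail_add_one hr.not_nil, length_rotate]

end Walk

open Walk in
/-- **Dirac's theorem**: a graph on at least three vertices in which every vertex has degree at
least half the number of vertices is Hamiltonian. -/
theorem IsHamiltonian.of_card_le_two_mul_degree [Fintype V] [DecidableEq V] [DecidableRel G.Adj]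
    (hcard : 3 ≤ Fintype.card V) (hdeg : ∀ v, Fintype.card V ≤ 2 * G.degree v) :
    G.IsHamiltonian := by
  intro _
  have : Nonempty V := Fintype.card_pos_iff.1 (by omega)
  obtain ⟨u, v, p, hp, hmax⟩ := Walk.exists_isPath_forall_isPath_length_le_length G
  have hvmem : ∀ w, G.Adj v w → w ∈ p.support := fun w =>
    hp.mem_support_of_adj_of_length_maximal hmax
  have humem : ∀ w, G.Adj u w → w ∈ p.support := fun w hw => by
    simpa using hp.reverse.mem_support_of_adj_of_length_maximal (by simpa using hmax) hw
  have hlt := hp.length_lt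
  let A := {i ∈ Finset.range p.length | G.Adj u (p.getVert (i + 1))}
  let B := {i ∈ Finset.range p.length | G.Adj v (p.getVert i)}
  have hAsub : A ⊆ Finset.range p.length := Finset.filter_subset _ _
  have hBsub : B ⊆ Finset.range p.length := Finset.filter_subset _ _
  have hBcard : B.card ≤ p.length := by simpa using Finset.card_le_card hBsub
  have hA : G.degree u ≤ A.card := by
    refine (Finset.card_le_card (t := A.image fun i => p.getVert (i + 1)) fun w hw => ?_).trans
      Finset.card_image_le
    rw [mem_neighborFinset] at hw
    obtain ⟨n, rfl, hn⟩ := mem_support_iff_exists_getVert.1 (humem w hw)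
    obtain _ | n := n
    · simp at hw
    · exact Finset.mem_image.2 ⟨n, by simp [A, hw]; omega, rfl⟩
  have hB : G.degree v ≤ B.card := by
    refine (Finset.card_le_card (t := B.image p.getVert) fun w hw => ?_).trans
      Finset.card_image_le
    rw [mem_neighborFinset] at hw
    obtain ⟨n, rfl, hn⟩ := mem_support_iff_exists_getVert.1 (hvmem w hw)
    obtain rfl | hn := hn.eq_or_lt
    · simp at hw
    · exact Finset.mem_image.2 ⟨n, by simp [B, hw, hn], rfl⟩
  have hlen : 2 ≤ p.length := by
    have := hdeg v
    omega
  obtain ⟨i, hi⟩ := Finset.inter_nonempty_of_card_lt_card_add_card hAsub hBsub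
    (by have := hdeg u; have := hdeg v; rw [Finset.card_range]; omega)
  simp only [A, B, Finset.mem_inter, Finset.mem_filter, Finset.mem_range] at hi
  obtain ⟨a, b, q, hq, hba, hperm⟩ := hp.exists_isPath_adj_of_crossing hi.1.1 hi.1.2 hi.2.2
  have hqlen : q.length = p.length := by simpa using hperm.length_eq
  have hc := hq.isCycle_cons (by omega) hba
  refine ⟨b, _, isHamiltonianCycle_iff_isCycle_and_length_eq.2 ⟨hc, ?_⟩⟩
  by_contra hne
  have hcard_supp : q.support.toFinset.card = p.length + 1 := by
    rw [List.toFinset_card_of_nodup hq.support_nodup, length_support, hqlen]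
  obtain ⟨y, hy⟩ : ∃ y, y ∉ q.support := by
    by_contra! hall
    have : q.support.toFinset = Finset.univ := by ext; simp [hall]
    rw [this, Finset.card_univ] at hcard_supp
    rw [length_cons] at hne
    omega
  obtain ⟨x, hxy, hx⟩ : ∃ x, G.Adj y x ∧ x ∈ q.support := by
    by_contra! hnone
    have hsub : G.neighborFinset y ⊆ (q.support.toFinset)ᶜ := fun x hx => by
      simpa using hnone x (by simpa using hx)
    have h1 := Finset.card_le_card hsub
    rw [Finset.card_compl, card_neighborFinset_eq_degree] at h1
    have := hdeg v
    have := hdeg y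
    omega
  obtain ⟨_, r, hr, hrlen⟩ := hc.exists_isPath_length_eq (x := x) (y := y)
    (by simp [hx]) (by simp [hy]; rintro rfl; simp at hy) hxy.symm
  have := hmax _ _ r hr
  rw [length_cons] at hrlen
  omega

end SimpleGraph

/-- **Correctness of the max-ISL constraints.** Let `W : 𝒥 × 𝒥 → {0,1}` be a symmetric
inter-satellite-link indicator with zero diagonal, and let a binary placement `x`
satisfy `Σ_j x j ≥ 3` and, for every `k`, `Σ_{j ≠ k} W j k · x j ≥ (1/2) Σ_j x j`.
Then the simple graph on the selected slots `S = {j : x j = 1}`, in which distinct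
slots `j, k` are adjacent exactly when `W j k = 1`, contains a Hamiltonian cycle. -/
theorem maxISL_hamiltonian
    (J : Type*) [Fintype J] [DecidableEq J]
    (W : J → J → ℝ) (hWbin : ∀ j k, W j k = 0 ∨ W j k = 1)
    (hWsymm : ∀ j k, W j k = W k j) (hWdiag : ∀ j, W j j = 0)
    (x : J → ℝ) (hx : ∀ j, x j = 0 ∨ x j = 1)
    (hcard : (3 : ℝ) ≤ ∑ j : J, x j)
    (hdeg : ∀ k : J, (1 / 2 : ℝ) * ∑ j : J, x j ≤
      ∑ j ∈ Finset.univ.erase k, W j k * x j) :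
    ∃ (a : {j : J // x j = 1})
      (w : (SimpleGraph.fromRel
        (fun u v : {j : J // x j = 1} => W u.1 v.1 = 1)).Walk a a),
      w.IsHamiltonianCycle := by
  classical
  have hsum : ∑ j : J, x j = Fintype.card {j : J // x j = 1} := by
    rw [Fintype.card_subtype, Finset.card_filter, Nat.cast_sum]
    refine Finset.sum_congr rfl fun j _ => ?_
    rcases hx j with h | h <;> simp [h]
  rw [hsum] at hcard hdeg
  have hcard' : 3 ≤ Fintype.card {j : J // x j = 1} := by exact_mod_cast hcard
  refine SimpleGraph.IsHamiltonian.of_card_le_two_mul_degree hcard' (fun v => ?_) (by omega)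
  have hlinks : ∑ j ∈ Finset.univ.erase v.1, W j v * x j =
      ({j ∈ Finset.univ.erase v.1 | W j v = 1 ∧ x j = 1}.card : ℝ) := by
    rw [Finset.card_filter, Nat.cast_sum]
    refine Finset.sum_congr rfl fun j _ => ?_
    rcases hx j with h | h <;> rcases hWbin j v with h' | h' <;> simp [h, h']
  have hle : {j ∈ Finset.univ.erase v.1 | W j v = 1 ∧ x j = 1}.card ≤
      (SimpleGraph.fromRel fun u v : {j : J // x j = 1} => W u.1 v.1 = 1).degree v := by
    rw [← SimpleGraph.card_neighborFinset_eq_degree,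
      ← Finset.card_map (Function.Embedding.subtype _)]
    refine Finset.card_le_card fun j hj => ?_
    simp only [Finset.mem_filter, Finset.mem_erase, Finset.mem_univ, and_true] at hj
    refine Finset.mem_map.2 ⟨⟨j, hj.2.2⟩, ?_, rfl⟩
    rw [SimpleGraph.mem_neighborFinset, SimpleGraph.fromRel_adj]
    exact ⟨fun h => hj.1 (congrArg Subtype.val h).symm, .inr hj.2.1⟩
  have hle' := (hdeg v).trans (hlinks.le.trans (Nat.cast_le.2 hle))
  have : (Fintype.card {j : J // x j = 1} : ℝ) ≤ 2 * ((SimpleGraph.fromRel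
      fun u v : {j : J // x j = 1} => W u.1 v.1 = 1).degree v : ℝ) := by linarith
  exact_mod_cast this
end
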